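/- Let n ≥ 2 and let v_0, …, v_{n−1} be distinct nodes with the cyclic demand set E = {(v_i, v_{(i+1) mod n}) : 0 ≤ i ≤ n−1}. Then every 2-hop solution for E in which all flights are of the form 'source to a fixed coordinator node K' or 'K to destination', with K one of the nodes v_0, …, v_{n−1}, has length at least 2n − 2; together with the fact that the minimum multihop solution length for E is n, this exhibits an instance on which the coordinator scheme uses (2 − 2/n) times the optimum number of pigeons. -/

import Mathlib

/-- A demand `(i,j)` is served by schedule `L` along a path of length `ℓ ≥ 1`:
there are flights at increasing positions of `L` forming a path `i = w₀, w₁, …, w_ℓ = j`.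
This is encoded by a node list `w` of length `ℓ + 1` whose list of consecutive pairs
is a sublist (ordered subsequence) of `L`. -/
def ServesPath {V : Type*} (L : List (V × V)) (i j : V) (ℓ : ℕ) : Prop :=
  1 ≤ ℓ ∧ ∃ w : List V, w.length = ℓ + 1 ∧ w.head? = some i ∧ w.getLast? = some j ∧
    (w.zip w.tail).Sublist L

/-- `L` is a multihop solution for the demand set `E`: every demand is served
along a path of some length `ℓ ≥ 1`. -/
def IsMultihopSolution {V : Type*} (L : List (V × V)) (E : Finset (V × V)) : Prop :=
  ∀ p ∈ E, ∃ ℓ, ServesPath L p.1 p.2 ℓ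

/-- `L` is a 2-hop solution for the demand set `E`: every demand is served
along a path of length at most 2. -/
def IsTwoHopSolution {V : Type*} (L : List (V × V)) (E : Finset (V × V)) : Prop :=
  ∀ p ∈ E, ∃ ℓ ≤ 2, ServesPath L p.1 p.2 ℓ

/-- Node `v` is incident to some demand of `E`. -/
def Touches {V : Type*} (E : Finset (V × V)) (v : V) : Prop :=
  ∃ p ∈ E, p.1 = v ∨ p.2 = v

/-- `E` is weakly connected: in the undirected graph on the nodes incident to some
demand, with an edge `{u,v}` whenever `(u,v) ∈ E` or `(v,u) ∈ E`, every two incident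
nodes are joined by a path. -/
def WeaklyConnected {V : Type*} (E : Finset (V × V)) : Prop :=
  ∀ u v : V, Touches E u → Touches E v →
    Relation.ReflTransGen (fun a b => (a, b) ∈ E ∨ (b, a) ∈ E) u v

theorem ServesPath.exists_flight_from {V : Type*} {L : List (V × V)} {i j : V} {ℓ : ℕ}
    (h : ServesPath L i j ℓ) : ∃ f ∈ L, f.1 = i := by
  obtain ⟨hℓ, w, hlen, hi, -, hsub⟩ := h
  match w, hlen, hi, hsub with
  | [_], hlen, _, _ => simp at hlen; omega
  | a :: b :: l, _, hi, hsub =>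
    exact ⟨(a, b), hsub.subset (by simp), by simpa using hi⟩

theorem ServesPath.exists_flight_to {V : Type*} {L : List (V × V)} {i j : V} {ℓ : ℕ}
    (h : ServesPath L i j ℓ) : ∃ f ∈ L, f.2 = j := by
  obtain ⟨hℓ, w, hlen, -, hj, hsub⟩ := h
  have hlt : ℓ - 1 < (w.zip w.tail).length := by simp; omega
  refine ⟨(w.zip w.tail)[ℓ - 1], hsub.subset (List.getElem_mem hlt), ?_⟩
  rw [List.getLast?_eq_getElem?, hlen, List.getElem?_eq_some_iff] at hj
  obtain ⟨_, hj⟩ := hj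
  simp only [List.getElem_zip, List.getElem_tail, ← hj]
  congr 1
  omega

theorem servesPath_one_of_mem {V : Type*} {L : List (V × V)} {i j : V} (h : (i, j) ∈ L) :
    ServesPath L i j 1 :=
  ⟨le_rfl, [i, j], rfl, rfl, rfl, by simpa using h⟩

theorem Finset.card_le_length_of_forall_mem {α : Type*} [DecidableEq α] {s : Finset α}
    {l : List α} (h : ∀ a ∈ s, a ∈ l) : s.card ≤ l.length :=
  (Finset.card_le_card fun a ha => List.mem_toFinset.2 (h a ha)).trans l.toFinset_card_le

/-- Tightness of the coordinator scheme on the cyclic instance (`n = m + 2 ≥ 2` distinct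
nodes, demands `(v i, v (i+1 mod n))`): every 2-hop solution all of whose flights go
from some node of the instance to a fixed coordinator node `v K` or from `v K` to some
node of the instance has length at least `2n − 2`, while the minimum multihop solution
length is exactly `n` — so the coordinator scheme uses `(2 − 2/n)` times the optimum. -/
theorem coordinator_tightness {V : Type*} [Fintype V] [DecidableEq V]
    (m : ℕ) (v : Fin (m + 2) → V) (hv : Function.Injective v) :
    (∀ K : Fin (m + 2), ∀ L : List (V × V),
      (∀ f ∈ L, (f.2 = v K ∧ f.1 ∈ Set.range v) ∨ (f.1 = v K ∧ f.2 ∈ Set.range v)) →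
      IsTwoHopSolution L
        (Finset.image (fun i : Fin (m + 2) => (v i, v (i + 1))) Finset.univ) →
      2 * (m + 2) - 2 ≤ L.length) ∧
    IsLeast {k | ∃ L : List (V × V),
      IsMultihopSolution L
        (Finset.image (fun i : Fin (m + 2) => (v i, v (i + 1))) Finset.univ) ∧
      L.length = k} (m + 2) := by
  refine ⟨fun K L hL hsol => ?_, ⟨List.ofFn fun i => (v i, v (i + 1)), ?_, by simp⟩, ?_⟩
  · have hserved (i : Fin (m + 2)) : ∃ ℓ, ServesPath L (v i) (v (i + 1)) ℓ := by
      obtain ⟨ℓ, -, h⟩ := hsol (v i, v (i + 1))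
        (Finset.mem_image_of_mem _ (Finset.mem_univ i))
      exact ⟨ℓ, h⟩
    have hto (i : Fin (m + 2)) (hi : i ≠ K) : (v i, v K) ∈ L := by
      obtain ⟨ℓ, h⟩ := hserved i
      obtain ⟨⟨a, b⟩, hf, rfl⟩ := h.exists_flight_from
      rcases hL _ hf with ⟨rfl, -⟩ | ⟨h, -⟩
      · exact hf
      · exact absurd (hv h) hi
    have hfrom (i : Fin (m + 2)) (hi : i ≠ K) : (v K, v i) ∈ L := by
      obtain ⟨ℓ, h⟩ := hserved (i - 1)
      rw [sub_add_cancel] at h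
      obtain ⟨⟨a, b⟩, hf, rfl⟩ := h.exists_flight_to
      rcases hL _ hf with ⟨h, -⟩ | ⟨rfl, -⟩
      · exact absurd (hv h) hi
      · exact hf
    let S := Finset.univ.erase K
    have hdisj : Disjoint (S.image fun i => (v i, v K)) (S.image fun i => (v K, v i)) := by
      rw [Finset.disjoint_left]
      simp only [S, Finset.mem_image, Finset.mem_erase, Finset.mem_univ, and_true]
      rintro _ ⟨i, hi, rfl⟩ ⟨j, -, hj⟩
      exact hi (hv (Prod.ext_iff.1 hj).1.symm)
    have hcard := Finset.card_le_length_of_forall_mem (l := L)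
      (s := (S.image fun i => (v i, v K)) ∪ (S.image fun i => (v K, v i))) (by
        simp only [S, Finset.mem_union, Finset.mem_image, Finset.mem_erase, Finset.mem_univ,
          and_true]
        rintro _ (⟨i, hi, rfl⟩ | ⟨i, hi, rfl⟩)
        exacts [hto i hi, hfrom i hi])
    rw [Finset.card_union_of_disjoint hdisj,
      Finset.card_image_of_injective _ fun i j h => hv (Prod.ext_iff.1 h).1,
      Finset.card_image_of_injective _ fun i j h => hv (Prod.ext_iff.1 h).2,
      Finset.card_erase_of_mem (Finset.mem_univ K), Finset.card_univ, Fintype.card_fin] at hcard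
    omega
  · intro p hp
    obtain ⟨i, -, rfl⟩ := Finset.mem_image.1 hp
    exact ⟨1, servesPath_one_of_mem (List.mem_ofFn.2 ⟨i, rfl⟩)⟩
  · rintro k ⟨L, hL, rfl⟩
    have hcard := Finset.card_le_length_of_forall_mem (s := Finset.univ.image v)
      (l := L.map Prod.fst) (by
      simp only [Finset.mem_image, Finset.mem_univ, true_and]
      rintro _ ⟨i, rfl⟩
      obtain ⟨ℓ, h⟩ := hL (v i, v (i + 1))
        (Finset.mem_image_of_mem _ (Finset.mem_univ i))
      exact List.mem_map.2 h.exists_flight_from)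
    simpa [Finset.card_image_of_injective _ hv] using hcard
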